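/- Let φ : [0,∞) → ℝ be continuous, non-negative, not identically zero, and integrable (∫₀^∞ φ(r) dr < ∞). Let (c_k)_{k ∈ ℕ} ⊆ [0,1] and (σ_k)_{k ∈ ℕ} ⊆ (0,∞) be such that for every t₀ ∈ (0,1) there exists a subsequence of indices (k_n) with c_{k_n} → t₀ and σ_{k_n} → 0. If u : [0,1] → ℝ is continuous and satisfies ∫₀¹ u(t) · φ(|t − c_k|/σ_k) dt = 0 for every k ∈ ℕ, then u is identically zero on [0,1]. -/

import Mathlib

open MeasureTheory Filter

/-- Integrals of a bounded function against a rescaled integrable kernel that concentrates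
at a continuity point converge to the value at that point times the mass of the kernel. -/
theorem tendsto_integral_comp_affine_mul {v ψ : ℝ → ℝ} {M t₀ : ℝ} {a s : ℕ → ℝ}
    (hv : Measurable v) (hM : ∀ x, ‖v x‖ ≤ M) (hvt : ContinuousAt v t₀)
    (hψ : Integrable ψ) (ha : Tendsto a atTop (nhds t₀)) (hs : Tendsto s atTop (nhds 0)) :
    Tendsto (fun n => ∫ x, v (a n + s n * x) * ψ x) atTop (nhds (v t₀ * ∫ x, ψ x)) := by
  rw [← integral_const_mul]
  refine tendsto_integral_of_dominated_convergence (fun x => M * ‖ψ x‖) (fun n => ?_)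
    (hψ.norm.const_mul M) (fun n => .of_forall fun x => ?_) (.of_forall fun x => ?_)
  · exact (hv.comp (by fun_prop)).aestronglyMeasurable.mul hψ.aestronglyMeasurable
  · rw [norm_mul]
    exact mul_le_mul_of_nonneg_right (hM _) (norm_nonneg _)
  · refine (hvt.tendsto.comp ?_).mul_const _
    simpa using ha.add (hs.mul_const x)


/-- With `φ` continuous, non-negative, not identically zero and integrable on
`[0,∞)`, and centers/shapes accumulating at every interior point with shapes tending to `0`, any
continuous `u : [0,1] → ℝ` orthogonal to all the RBF atoms `t ↦ φ(|t − c_k|/σ_k)` vanishes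
identically on `[0,1]`. -/
theorem rbf_orthogonal_continuous_eq_zero (φ : ℝ → ℝ)
    (hcont : ContinuousOn φ (Set.Ici 0))
    (hnn : ∀ r : ℝ, 0 ≤ r → 0 ≤ φ r)
    (hne : ∃ r : ℝ, 0 ≤ r ∧ φ r ≠ 0)
    (hint : IntegrableOn φ (Set.Ici 0))
    (c σ : ℕ → ℝ) (hc : ∀ k, c k ∈ Set.Icc (0:ℝ) 1) (hσ : ∀ k, 0 < σ k)
    (hacc : ∀ t₀ ∈ Set.Ioo (0:ℝ) 1, ∃ k : ℕ → ℕ, StrictMono k ∧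
      Tendsto (fun n => c (k n)) atTop (nhds t₀) ∧
      Tendsto (fun n => σ (k n)) atTop (nhds 0))
    (u : ℝ → ℝ) (hu : ContinuousOn u (Set.Icc 0 1))
    (horth : ∀ k, (∫ t in Set.Icc (0:ℝ) 1, u t * φ (|t - c k| / σ k)) = 0) :
    ∀ t ∈ Set.Icc (0:ℝ) 1, u t = 0 := by
  have hψc : Continuous fun x : ℝ => φ |x| :=
    hcont.comp_continuous continuous_abs fun x => abs_nonneg x
  have hψi : Integrable fun x : ℝ => φ |x| := by
    have hIci : IntegrableOn (fun x : ℝ => φ |x|) (Set.Ici 0) :=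
      hint.congr_fun (fun x hx => by rw [abs_of_nonneg hx]) measurableSet_Ici
    have hIic : IntegrableOn (fun x : ℝ => φ |x|) (Set.Iic 0) := by
      rw [← neg_zero] at hIci
      simpa only [abs_neg] using hIci.comp_neg_Iic
    rw [← integrableOn_univ, ← Set.Iic_union_Ici]
    exact hIic.union hIci
  have hψpos : (∫ x : ℝ, φ |x|) ≠ 0 := by
    intro h
    rw [integral_eq_zero_iff_of_nonneg (fun x => hnn _ (abs_nonneg x)) hψi,
      hψc.ae_eq_iff_eq volume continuous_zero] at h
    obtain ⟨r, hr, hr'⟩ := hne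
    exact hr' (by simpa [abs_of_nonneg hr] using congrFun h r)
  obtain ⟨M, hM⟩ := isCompact_Icc.exists_bound_of_continuousOn hu
  have hM0 : 0 ≤ M := (norm_nonneg _).trans (hM 0 (by simp))
  set v : ℝ → ℝ := (Set.Icc (0 : ℝ) 1).indicator u with hv
  have hvm : Measurable v := by
    classical
    rw [hv, ← Set.piecewise_eq_indicator]
    exact hu.measurable_piecewise continuousOn_const measurableSet_Icc
  have hvM : ∀ x, ‖v x‖ ≤ M := fun x => by
    by_cases hx : x ∈ Set.Icc (0 : ℝ) 1
    · simpa [hv, hx] using hM x hx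
    · simpa [hv, hx] using hM0
  have hzero : ∀ k, ∫ x, v (c k + σ k * x) * φ |x| = 0 := fun k => by
    have h1 : ∫ t, v t * φ (|t - c k| / σ k) = 0 := by
      rw [← horth k, ← integral_indicator measurableSet_Icc]
      simp only [hv, Set.indicator_mul_left]
    have h2 := Measure.integral_comp_mul_left
      (fun y => v (c k + y) * φ (|c k + y - c k| / σ k)) (σ k)
    rw [integral_add_left_eq_self (fun t => v t * φ (|t - c k| / σ k)) (c k), h1,
      smul_zero] at h2
    rw [← h2]
    congr with x
    rw [add_sub_cancel_left, abs_mul, abs_of_pos (hσ k), mul_div_cancel_left₀ _ (hσ k).ne']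
  have hIoo : Set.EqOn u 0 (Set.Ioo 0 1) := fun t ht => by
    obtain ⟨k, -, hck, hσk⟩ := hacc t ht
    have hvu : v =ᶠ[nhds t] u := by
      filter_upwards [Icc_mem_nhds ht.1 ht.2] with x hx using Set.indicator_of_mem hx u
    have hvt : ContinuousAt v t :=
      (hu.continuousAt (Icc_mem_nhds ht.1 ht.2)).congr hvu.symm
    have hlim := tendsto_integral_comp_affine_mul hvm hvM hvt hψi hck hσk
    simp only [hzero] at hlim
    have h := tendsto_nhds_unique hlim tendsto_const_nhds
    rw [← hvu.eq_of_nhds]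
    exact (mul_eq_zero.1 h).resolve_right hψpos
  exact hIoo.of_subset_closure hu continuousOn_const Set.Ioo_subset_Icc_self
    (closure_Ioo zero_ne_one).ge
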